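/- In 𝒟_n the following commutation relations hold. (1) w_i^r w_i^s = q^{2·sgn(r−s)} w_i^s w_i^r for all −i ≤ r, s ≤ i−1. (2) w_i^r w_j^s = w_j^s w_i^r whenever |i−j| > 1. (3) For −i ≤ t ≤ i−1 and −(i+1) ≤ r ≤ i: w_{i+1}^r w_i^t = q^{−1} w_i^t w_{i+1}^r if t ⊲ r, and w_{i+1}^r w_i^t = q w_i^t w_{i+1}^r if t ⊳ r, where t ⊲ r means (t ≤ r if r < 0, and t < r if r ≥ 0) and t ⊳ r is its negation. (4)–(6) The same three relations hold with m in place of w throughout. (7) For 1 ≤ i, j ≤ n, −i ≤ r ≤ i−1, −j ≤ s ≤ j−1: if i + j < n+1 then w_i^r m_j^s = m_j^s w_i^r; if i + j = n+1 then w_i^r m_j^s = q² m_j^s w_i^r when (r,s) = (−i, j−1), w_i^r m_j^s = q^{−2} m_j^s w_i^r when (r,s) = (i−1, −j), and w_i^r m_j^s = m_j^s w_i^r otherwise; if i + j > n+1 then w_i^r m_j^s = q² m_j^s w_i^r when (r,s) ∈ {(θ(j), −θ(i)−1), (−θ(j), θ(i)−1)}, w_i^r m_j^s = q^{−2} m_j^s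 w_i^r when (r,s) ∈ {(−θ(j)−1, θ(i)), (θ(j)−1, −θ(i))}, and w_i^r m_j^s = m_j^s w_i^r otherwise. -/

import Mathlib

noncomputable section

/-- The ground field `𝕂 = ℂ(q)`, the field of rational functions over `ℂ`. -/
abbrev Kq : Type := RatFunc ℂ

/-- The formal variable `q ∈ ℂ(q)`. -/
def qq : Kq := RatFunc.X

/-- `𝐢 = √−1 ∈ ℂ`, viewed as a constant in `𝕂 = ℂ(q)`. -/
def ii : Kq := RatFunc.C Complex.I

/-- `θ(i) = n + 1 − i`. -/
def th (n : ℕ) (i : ℤ) : ℤ := (n : ℤ) + 1 - i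

/-- Labels for the vertices of the `𝒟ₙ`-quiver: `V i r` stands for `V_{i,r}`
(the canonical labels), and `C i` stands for the central vertex `Λ_{i,0}`. -/
inductive DnLabel : Type
  | V : ℤ → ℤ → DnLabel
  | C : ℤ → DnLabel
deriving DecidableEq

/-- Validity of a label for given rank `n`: `V i r` requires `1 ≤ i ≤ n`, `−i ≤ r ≤ i`;
`C i` requires `1 ≤ i ≤ n`.  There are `n² + 3n` valid labels. -/
def DnLabel.valid (n : ℕ) : DnLabel → Prop
  | .V i r => 1 ≤ i ∧ i ≤ (n : ℤ) ∧ -i ≤ r ∧ r ≤ i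
  | .C i => 1 ≤ i ∧ i ≤ (n : ℤ)

instance (n : ℕ) (v : DnLabel) : Decidable (v.valid n) := by
  cases v <;> unfold DnLabel.valid <;> infer_instance

/-- The vertex set of the `𝒟ₙ`-quiver. -/
def DnVertex (n : ℕ) := {v : DnLabel // v.valid n}

/-- The canonical label of the vertex `Λ_{i,r}`, using the identifications
`Λ_{a,b} = V_{θ(b),−θ(a)}` for `b > 0` and `Λ_{a,b} = V_{θ(−b),θ(a)}` for `b < 0`. -/
def Lam (n : ℕ) (i r : ℤ) : DnLabel :=
  if 0 < r then .V (th n r) (-(th n i))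
  else if r < 0 then .V (th n (-r)) (th n i)
  else .C i

/-- The list of arrows `(source, target, doubled weight)` of the `𝒟ₙ`-quiver, obtained by
amalgamating two copies of the Fock–Goncharov `(n+1)`-triangle quiver along two pairs of
sides.  Solid (weight `1`) arrows get doubled weight `2`, dashed (weight `1/2`) arrows get
doubled weight `1`.  The families are: the horizontal `V_i`- and `Λ_i`-path arrows, the
dashed boundary arrows along the two frozen columns, and, for each `1 ≤ i < n`, the
oriented cycle `V_{i,0} → V_{i+1,−1} → ⋯ → V_{n,i−n} → Λ_{i,0} → V_{n,n−i} → ⋯ → V_{i+1,1} → V_{i,0}`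
through the central column. -/
def dnArrows (n : ℕ) : List (DnLabel × DnLabel × ℤ) :=
  ((List.range n).flatMap fun i0 =>
    (List.range (2 * i0 + 2)).map fun k =>
      (DnLabel.V ((i0 : ℤ) + 1) (-((i0 : ℤ) + 1) + k),
       DnLabel.V ((i0 : ℤ) + 1) (-((i0 : ℤ) + 1) + k + 1), 2))
  ++ ((List.range n).flatMap fun i0 =>
    (List.range (2 * i0 + 2)).map fun k =>
      (Lam n ((i0 : ℤ) + 1) (-((i0 : ℤ) + 1) + k),
       Lam n ((i0 : ℤ) + 1) (-((i0 : ℤ) + 1) + k + 1), 2))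
  ++ ((List.range (n - 1)).map fun i0 =>
      (DnLabel.V ((i0 : ℤ) + 1) (-((i0 : ℤ) + 1)),
       DnLabel.V ((i0 : ℤ) + 2) (-((i0 : ℤ) + 2)), 1))
  ++ ((List.range (n - 1)).map fun i0 =>
      (DnLabel.V ((i0 : ℤ) + 2) ((i0 : ℤ) + 2),
       DnLabel.V ((i0 : ℤ) + 1) ((i0 : ℤ) + 1), 1))
  ++ ((List.range (n - 1)).flatMap fun i0 =>
      (((List.range (n - 1 - i0)).map fun k =>
          (DnLabel.V ((i0 : ℤ) + 1 + k) (-(k : ℤ)),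
           DnLabel.V ((i0 : ℤ) + 2 + k) (-(k : ℤ) - 1), 2))
        ++ [(DnLabel.V (n : ℤ) ((i0 : ℤ) + 1 - n), DnLabel.C ((i0 : ℤ) + 1), 2),
            (DnLabel.C ((i0 : ℤ) + 1), DnLabel.V (n : ℤ) ((n : ℤ) - (i0 + 1)), 2)]
        ++ ((List.range (n - 1 - i0)).map fun k =>
          (DnLabel.V ((i0 : ℤ) + 2 + k) ((k : ℤ) + 1),
           DnLabel.V ((i0 : ℤ) + 1 + k) (k : ℤ), 2))))

/-- The doubled exchange matrix `2·ε_{uv}` of the `𝒟ₙ`-quiver. -/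
def eps2 (n : ℕ) (u v : DnLabel) : ℤ :=
  ((dnArrows n).map fun a =>
    (if a.1 = u ∧ a.2.1 = v then a.2.2 else 0)
      - (if a.1 = v ∧ a.2.1 = u then a.2.2 else 0)).sum

/-- The defining relations of the quantum torus algebra `𝒟ₙ`: generators `X_v^{±1}`
(`Sum.inl v` is `X_v`, `Sum.inr v` is `X_v⁻¹`) with `X_u X_v = q^{2 ε_{vu}} X_v X_u`. -/
inductive DnRel (n : ℕ) :
    FreeAlgebra Kq (DnVertex n ⊕ DnVertex n) →
      FreeAlgebra Kq (DnVertex n ⊕ DnVertex n) → Prop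
  | comm (u v : DnVertex n) :
      DnRel n (FreeAlgebra.ι Kq (Sum.inl u) * FreeAlgebra.ι Kq (Sum.inl v))
        ((qq ^ eps2 n v.1 u.1) • (FreeAlgebra.ι Kq (Sum.inl v) * FreeAlgebra.ι Kq (Sum.inl u)))
  | mul_inv (v : DnVertex n) :
      DnRel n (FreeAlgebra.ι Kq (Sum.inl v) * FreeAlgebra.ι Kq (Sum.inr v)) 1
  | inv_mul (v : DnVertex n) :
      DnRel n (FreeAlgebra.ι Kq (Sum.inr v) * FreeAlgebra.ι Kq (Sum.inl v)) 1

/-- The quantum torus algebra `𝒟ₙ`. -/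
abbrev Dtorus (n : ℕ) := RingQuot (DnRel n)

/-- The cluster variable `X_v ∈ 𝒟ₙ` attached to a label (junk value `1` on invalid labels). -/
def Xg (n : ℕ) (v : DnLabel) : Dtorus n :=
  if h : v.valid n then RingQuot.mkAlgHom Kq (DnRel n) (FreeAlgebra.ι Kq (Sum.inl ⟨v, h⟩)) else 1

/-- The inverse cluster variable `X_v⁻¹ ∈ 𝒟ₙ` (junk value `1` on invalid labels). -/
def Xinv (n : ℕ) (v : DnLabel) : Dtorus n :=
  if h : v.valid n then RingQuot.mkAlgHom Kq (DnRel n) (FreeAlgebra.ι Kq (Sum.inr ⟨v, h⟩)) else 1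

/-- The ordered product `X_{V_{i,−i}} X_{V_{i,1−i}} ⋯ X_{V_{i,r}}`. -/
def Vprod (n : ℕ) (i r : ℤ) : Dtorus n :=
  ((List.range (r + i + 1).toNat).map fun k => Xg n (.V i (-i + k))).prod

/-- The ordered product `X_{Λ_{i,−i}} X_{Λ_{i,1−i}} ⋯ X_{Λ_{i,r}}`. -/
def Lprod (n : ℕ) (i r : ℤ) : Dtorus n :=
  ((List.range (r + i + 1).toNat).map fun k => Xg n (Lam n i (-i + k))).prod

/-- `w_i^r = 𝐢 q^{i+r} X_{V_{i,−i}} X_{V_{i,1−i}} ⋯ X_{V_{i,r}}`. -/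
def ww (n : ℕ) (i r : ℤ) : Dtorus n := (ii * qq ^ (i + r)) • Vprod n i r

/-- `m_i^r = 𝐢 q^{i+r} X_{Λ_{i,−i}} X_{Λ_{i,1−i}} ⋯ X_{Λ_{i,r}}`. -/
def mm (n : ℕ) (i r : ℤ) : Dtorus n := (ii * qq ^ (i + r)) • Lprod n i r


/-- The order relation `t ⊲ r`: `t ≤ r` if `r < 0`, and `t < r` if `r ≥ 0`. -/
def lhd (t r : ℤ) : Prop := if r < 0 then t ≤ r else t < r

instance (t r : ℤ) : Decidable (lhd t r) := by unfold lhd; infer_instance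

/-! ### Sums of indicator functions over ranges -/

theorem sum_range_eq_zero {f : ℕ → ℤ} {N : ℕ} (h : ∀ k < N, f k = 0) :
    ((List.range N).map f).sum = 0 :=
  List.sum_eq_zero fun x hx => by
    obtain ⟨k, hk, rfl⟩ := List.mem_map.mp hx
    exact h k (List.mem_range.mp hk)

theorem sum_range_eq_single {f : ℕ → ℤ} {N a : ℕ} (ha : a < N) (h : ∀ k < N, k ≠ a → f k = 0) :
    ((List.range N).map f).sum = f a := by
  rw [List.sum_map_eq_nsmul_single a f fun k hk hk' => h k (List.mem_range.mp hk') hk,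
    List.nodup_range.count, if_pos (List.mem_range.mpr ha), one_smul]

theorem sum_range_ite {p : ℕ → Prop} [DecidablePred p] {N : ℕ} {Q : Prop} [Decidable Q]
    {w : ℤ} (a : ℕ) (h₁ : ∀ k < N, p k → k = a ∧ Q) (h₂ : Q → a < N ∧ p a) :
    ((List.range N).map fun k => if p k then w else 0).sum = if Q then w else 0 := by
  by_cases hQ : Q
  · rw [sum_range_eq_single (h₂ hQ).1 fun k hk hka => if_neg fun hp => hka (h₁ k hk hp).1,
      if_pos hQ, if_pos (h₂ hQ).2]
  · rw [if_neg hQ, sum_range_eq_zero fun k hk => if_neg fun hp => hQ (h₁ k hk hp).2]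

theorem sum_range_range_ite {p : ℕ → ℕ → Prop} [∀ i, DecidablePred (p i)] {N : ℕ} {M : ℕ → ℕ}
    {Q : Prop} [Decidable Q] {w : ℤ} (a b : ℕ)
    (h₁ : ∀ i < N, ∀ k < M i, p i k → i = a ∧ k = b ∧ Q) (h₂ : Q → a < N ∧ b < M a ∧ p a b) :
    ((List.range N).map fun i => ((List.range (M i)).map fun k => if p i k then w else 0).sum).sum
      = if Q then w else 0 := by
  by_cases hQ : Q
  · obtain ⟨ha, hb, hp⟩ := h₂ hQ
    rw [sum_range_eq_single ha fun i hi hia => sum_range_eq_zero fun k hk =>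
        if_neg fun hp => hia (h₁ i hi k hk hp).1,
      sum_range_eq_single hb fun k hk hkb => if_neg fun hp => hkb (h₁ a ha k hk hp).2.1,
      if_pos hQ, if_pos hp]
  · rw [if_neg hQ, sum_range_eq_zero fun i hi => sum_range_eq_zero fun k hk =>
      if_neg fun hp => hQ (h₁ i hi k hk hp).2.2]

/-! ### The exchange matrix -/

/-- The total doubled weight of the arrows from `u` to `v` in a list of arrows. -/
def arrowSum (L : List (DnLabel × DnLabel × ℤ)) (u v : DnLabel) : ℤ :=
  (L.map fun a => if a.1 = u ∧ a.2.1 = v then a.2.2 else 0).sum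

theorem arrowSum_append (L L' : List (DnLabel × DnLabel × ℤ)) (u v : DnLabel) :
    arrowSum (L ++ L') u v = arrowSum L u v + arrowSum L' u v := by
  simp [arrowSum]

theorem arrowSum_pair (x y : DnLabel × DnLabel × ℤ) (u v : DnLabel) :
    arrowSum [x, y] u v = (if x.1 = u ∧ x.2.1 = v then x.2.2 else 0)
      + if y.1 = u ∧ y.2.1 = v then y.2.2 else 0 := by
  simp [arrowSum]

theorem arrowSum_flatMap (f : ℕ → List (DnLabel × DnLabel × ℤ)) (N : ℕ) (u v : DnLabel) :
    arrowSum ((List.range N).flatMap f) u v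
      = ((List.range N).map fun i => arrowSum (f i) u v).sum := by
  generalize List.range N = L
  induction L with
  | nil => simp [arrowSum]
  | cons i L ih => rw [List.flatMap_cons, arrowSum_append, ih, List.map_cons, List.sum_cons]

theorem bind_pure_cast (L : List ℕ) :
    (do let a ← L; pure (a : ℤ)) = L.map fun k : ℕ => (k : ℤ) := by
  simp [← List.map_eq_flatMap]

theorem arrowSum_map (s t : ℤ → DnLabel) (w : ℤ) (N : ℕ) (u v : DnLabel) :
    arrowSum (((List.range N).map fun k : ℕ => (k : ℤ)).map fun k => (s k, t k, w)) u v
      = ((List.range N).map fun k : ℕ => if s k = u ∧ t k = v then w else 0).sum := by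
  simp [arrowSum, Function.comp_def]

theorem eps2_eq_arrowSum_sub (n : ℕ) (u v : DnLabel) :
    eps2 n u v = arrowSum (dnArrows n) u v - arrowSum (dnArrows n) v u := by
  unfold eps2 arrowSum
  generalize dnArrows n = L
  induction L with
  | nil => simp
  | cons a L ih => simp only [List.map_cons, List.sum_cons, ih]; ring

theorem arrowSum_dnArrows (n : ℕ) (u v : DnLabel) : arrowSum (dnArrows n) u v =
    ((List.range n).map fun i : ℕ => ((List.range (2 * i + 2)).map fun k : ℕ =>
      if DnLabel.V ((i : ℤ) + 1) (-((i : ℤ) + 1) + k) = u ∧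
        DnLabel.V ((i : ℤ) + 1) (-((i : ℤ) + 1) + k + 1) = v then (2 : ℤ) else 0).sum).sum
    + ((List.range n).map fun i : ℕ => ((List.range (2 * i + 2)).map fun k : ℕ =>
      if Lam n ((i : ℤ) + 1) (-((i : ℤ) + 1) + k) = u ∧
        Lam n ((i : ℤ) + 1) (-((i : ℤ) + 1) + k + 1) = v then (2 : ℤ) else 0).sum).sum
    + ((List.range (n - 1)).map fun i : ℕ =>
      if DnLabel.V ((i : ℤ) + 1) (-((i : ℤ) + 1)) = u ∧
        DnLabel.V ((i : ℤ) + 2) (-((i : ℤ) + 2)) = v then (1 : ℤ) else 0).sum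
    + ((List.range (n - 1)).map fun i : ℕ =>
      if DnLabel.V ((i : ℤ) + 2) ((i : ℤ) + 2) = u ∧
        DnLabel.V ((i : ℤ) + 1) ((i : ℤ) + 1) = v then (1 : ℤ) else 0).sum
    + ((List.range (n - 1)).map fun i : ℕ => ((List.range (n - 1 - i)).map fun k : ℕ =>
      if DnLabel.V ((i : ℤ) + 1 + k) (-(k : ℤ)) = u ∧
        DnLabel.V ((i : ℤ) + 2 + k) (-(k : ℤ) - 1) = v then (2 : ℤ) else 0).sum).sum
    + ((List.range (n - 1)).map fun i : ℕ =>
      if DnLabel.V (n : ℤ) ((i : ℤ) + 1 - n) = u ∧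
        DnLabel.C ((i : ℤ) + 1) = v then (2 : ℤ) else 0).sum
    + ((List.range (n - 1)).map fun i : ℕ =>
      if DnLabel.C ((i : ℤ) + 1) = u ∧
        DnLabel.V (n : ℤ) ((n : ℤ) - (i + 1)) = v then (2 : ℤ) else 0).sum
    + ((List.range (n - 1)).map fun i : ℕ => ((List.range (n - 1 - i)).map fun k : ℕ =>
      if DnLabel.V ((i : ℤ) + 2 + k) ((k : ℤ) + 1) = u ∧
        DnLabel.V ((i : ℤ) + 1 + k) (k : ℤ) = v then (2 : ℤ) else 0).sum).sum := by
  simp only [dnArrows, arrowSum_append, arrowSum_flatMap, bind_pure_cast, arrowSum_map,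
    arrowSum_pair, List.sum_map_add]
  ring

theorem Lam_eq_V_iff (n : ℕ) (i l a r : ℤ) : Lam n i l = .V a r ↔
    (0 < l ∧ a = n + 1 - l ∧ r = i - n - 1) ∨ (l < 0 ∧ a = n + 1 + l ∧ r = n + 1 - i) := by
  grind [Lam, th]

theorem Lam_eq_C_iff (n : ℕ) (i l b : ℤ) : Lam n i l = .C b ↔ l = 0 ∧ i = b := by
  grind [Lam]

theorem arrowSum_V_V (n : ℕ) (a r b s : ℤ) :
    arrowSum (dnArrows n) (.V a r) (.V b s) =
      (if (a = b ∧ s = r + 1 ∧ 1 ≤ a ∧ a ≤ n ∧ -a ≤ r ∧ r < a) then 2 else 0)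
      + (if (s = r ∧ ((b = a - 1 ∧ r < 0 ∧ -r < a ∧ a ≤ n) ∨ (b = a + 1 ∧ 1 ≤ r ∧ r ≤ a ∧ a < n)))
          then 2 else 0)
      + (if (b = a + 1 ∧ r = -a ∧ s = -b ∧ 1 ≤ a ∧ a < n) then 1 else 0)
      + (if (a = b + 1 ∧ r = a ∧ s = b ∧ 1 ≤ b ∧ b < n) then 1 else 0)
      + (if (b = a + 1 ∧ s = r - 1 ∧ r ≤ 0 ∧ -r < a ∧ a < n) then 2 else 0)
      + (if (a = b + 1 ∧ r = s + 1 ∧ 0 ≤ s ∧ s < b ∧ b < n) then 2 else 0) := by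
  rw [arrowSum_dnArrows]
  simp only [DnLabel.V.injEq, reduceCtorEq, Lam_eq_V_iff, and_false, false_and,
    if_false, List.map_const', List.sum_replicate, smul_zero, add_zero]
  congr 1; congr 1; congr 1; congr 1; congr 1
  · exact sum_range_range_ite (a - 1).toNat (r + a).toNat (by intros; omega)
      (by intros; omega)
  · exact sum_range_range_ite (if r < 0 then n + r else n - r).toNat
      (if r < 0 then 2 * n + 2 + r - a else a - r).toNat (by intros; omega)
      (by intros; omega)
  · exact sum_range_ite (a - 1).toNat (by intros; omega) (by intros; omega)
  · exact sum_range_ite (b - 1).toNat (by intros; omega) (by intros; omega)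
  · exact sum_range_range_ite (a + r - 1).toNat (-r).toNat (by intros; omega)
      (by intros; omega)
  · exact sum_range_range_ite (b - s - 1).toNat s.toNat (by intros; omega)
      (by intros; omega)

theorem arrowSum_V_C (n : ℕ) (a r b : ℤ) :
    arrowSum (dnArrows n) (.V a r) (.C b) =
      (if (a = n ∧ r = n + 1 - b ∧ 1 ≤ b ∧ b ≤ n) then 2 else 0)
      + (if (a = n ∧ r = b - n ∧ 1 ≤ b ∧ b < n) then 2 else 0) := by
  rw [arrowSum_dnArrows]
  simp only [DnLabel.V.injEq, DnLabel.C.injEq, reduceCtorEq, Lam_eq_V_iff, Lam_eq_C_iff, and_false,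
    if_false,
    List.map_const', List.sum_replicate, smul_zero, add_zero, zero_add]
  congr 1
  · exact sum_range_range_ite (b - 1).toNat (b - 1).toNat (by intros; omega)
      (by intros; omega)
  · exact sum_range_ite (b - 1).toNat (by intros; omega) (by intros; omega)

theorem arrowSum_C_V (n : ℕ) (a r b : ℤ) :
    arrowSum (dnArrows n) (.C b) (.V a r) =
      (if (a = n ∧ r = b - n - 1 ∧ 1 ≤ b ∧ b ≤ n) then 2 else 0)
      + (if (a = n ∧ r = n - b ∧ 1 ≤ b ∧ b < n) then 2 else 0) := by
  rw [arrowSum_dnArrows]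
  simp only [DnLabel.V.injEq, DnLabel.C.injEq, reduceCtorEq, Lam_eq_V_iff, Lam_eq_C_iff, and_false,
    false_and, if_false,
    List.map_const', List.sum_replicate, smul_zero, add_zero, zero_add]
  congr 1
  · exact sum_range_range_ite (b - 1).toNat b.toNat (by intros; omega)
      (by intros; omega)
  · exact sum_range_ite (b - 1).toNat (by intros; omega) (by intros; omega)

theorem arrowSum_C_C (n : ℕ) (a b : ℤ) :
    arrowSum (dnArrows n) (.C a) (.C b) = 0 := by
  rw [arrowSum_dnArrows]
  simp only [reduceCtorEq, Lam_eq_C_iff, and_false, false_and, if_false, List.map_const',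
    List.sum_replicate, smul_zero, add_zero, zero_add]
  exact sum_range_eq_zero fun i _ => sum_range_eq_zero fun k _ => if_neg (by omega)

theorem Lam_pos {n : ℕ} {i r : ℤ} (h : 0 < r) : Lam n i r = .V (n + 1 - r) (i - n - 1) := by
  grind [Lam, th]

theorem Lam_neg {n : ℕ} {i r : ℤ} (h : r < 0) : Lam n i r = .V (n + 1 + r) (n + 1 - i) := by
  grind [Lam, th]

theorem Lam_zero {n : ℕ} {i : ℤ} : Lam n i 0 = .C i := rfl

theorem Lam_valid {n : ℕ} {i r : ℤ} (hi : 1 ≤ i) (hin : i ≤ n) (hr : -i ≤ r) (hri : r ≤ i) :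
    (Lam n i r).valid n := by
  rcases lt_trichotomy r 0 with h | rfl | h
  · rw [Lam_neg h]; simp only [DnLabel.valid]; omega
  · exact ⟨hi, hin⟩
  · rw [Lam_pos h]; simp only [DnLabel.valid]; omega

/-- The rotation by 180 degrees is an automorphism of the quiver. -/
theorem eps2_Lam_Lam {n : ℕ} {a r b s : ℤ} (ha : 1 ≤ a) (han : a ≤ n) (hb : 1 ≤ b) (hbn : b ≤ n)
    (hr : -a ≤ r) (hra : r ≤ a) (hs : -b ≤ s) (hsb : s ≤ b) :
    eps2 n (Lam n a r) (Lam n b s) = eps2 n (.V a r) (.V b s) := by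
  rcases lt_trichotomy r 0 with h | rfl | h <;> rcases lt_trichotomy s 0 with h' | rfl | h' <;>
  simp only [Lam_pos, Lam_neg, Lam_zero, *] <;>
  simp only [eps2_eq_arrowSum_sub, arrowSum_V_V, arrowSum_V_C, arrowSum_C_V, arrowSum_C_C]
  all_goals simp (disch := omega) only [if_neg]
  all_goals repeat' (split <;> try simp (disch := omega) only [if_pos, if_neg])
  all_goals omega

/-! ### Exponents of `q` -/

/-- The exponent in the commutation relation of `w_i^r` and `w_i^s`. -/
def rowExp (i r s : ℤ) : ℤ :=
  if -i ≤ r ∧ -i ≤ s then (if s < r then 2 else if r < s then -2 else 0) else 0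

/-- The exponent in the commutation relation of `w_{i+1}^r` and `w_i^t`. -/
def adjExp (i r t : ℤ) : ℤ :=
  if -(i + 1) ≤ r ∧ -i ≤ t then (if r < 0 ∧ t ≤ r ∨ 0 ≤ r ∧ t < r then -1 else 1) else 0

/-- The exponent in the commutation relation of `w_i^r` and `m_j^s`. -/
def mixedExp (n : ℕ) (i j r s : ℤ) : ℤ :=
  (if r = n + 1 - j ∧ s = i - n - 2 then 2 else 0)
    + (if r = j - n - 1 ∧ s = n - i then 2 else 0)
    - (if r = j - n - 2 ∧ s = n + 1 - i then 2 else 0)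
    - (if r = n - j ∧ s = i - n - 1 then 2 else 0)

theorem eps2_V_V_far {n : ℕ} {i j r s : ℤ} (h : 1 < (i - j).natAbs) :
    eps2 n (.V j s) (.V i r) = 0 := by
  simp (disch := omega) only [eps2_eq_arrowSum_sub, arrowSum_V_V, if_neg]
  rfl

theorem eps2_V_V_row {n : ℕ} {i r s : ℤ} (hi : 1 ≤ i) (hin : i ≤ n) (hr : -i ≤ r) (hri : r < i)
    (hs : -i ≤ s) (hsi : s < i) :
    eps2 n (.V i s) (.V i r) =
      rowExp i r s - rowExp i (r - 1) s - rowExp i r (s - 1) + rowExp i (r - 1) (s - 1) := by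
  simp only [eps2_eq_arrowSum_sub, arrowSum_V_V, rowExp, true_and]
  simp (disch := omega) only [if_pos, if_neg]
  repeat' (split <;> try simp (disch := omega) only [if_pos, if_neg])
  all_goals omega

theorem eps2_V_V_adj {n : ℕ} {i r s : ℤ} (hi : 1 ≤ i) (hin : i + 1 ≤ n) (hr : -(i + 1) ≤ r)
    (hri : r ≤ i) (hs : -i ≤ s) (hsi : s < i) :
    eps2 n (.V i s) (.V (i + 1) r) =
      adjExp i r s - adjExp i (r - 1) s - adjExp i r (s - 1) + adjExp i (r - 1) (s - 1) := by
  simp only [eps2_eq_arrowSum_sub, arrowSum_V_V, adjExp, true_and]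
  simp (disch := omega) only [if_pos, if_neg]
  repeat' (split <;> try simp (disch := omega) only [if_pos, if_neg])
  all_goals omega

theorem eps2_Lam_V {n : ℕ} {i j r s : ℤ} (hi : 1 ≤ i) (hin : i ≤ n) (hj : 1 ≤ j) (hjn : j ≤ n)
    (hr : -i ≤ r) (hri : r < i) (hs : -j ≤ s) (hsj : s < j) :
    eps2 n (Lam n j s) (.V i r) =
      mixedExp n i j r s - mixedExp n i j (r - 1) s - mixedExp n i j r (s - 1)
        + mixedExp n i j (r - 1) (s - 1) := by
  simp only [mixedExp]
  rcases lt_trichotomy s 0 with h | rfl | h <;>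
  simp only [Lam_pos, Lam_neg, Lam_zero, *] <;>
  simp only [eps2_eq_arrowSum_sub, arrowSum_V_V, arrowSum_V_C, arrowSum_C_V]
  all_goals simp (disch := omega) only [if_neg]
  all_goals repeat' (split <;> try simp (disch := omega) only [if_pos, if_neg])
  all_goals omega

/-! ### Commutation up to powers of `q` -/

section QCommute

variable {K A : Type*} [Field K] [Ring A] [Algebra K A]

theorem mul_mul_eq_smul {c d : K} {x y z : A} (h : x * y = c • (y * x)) (h' : x * z = d • (z * x)) :
    x * (y * z) = (c * d) • (y * z * x) := by
  rw [← mul_assoc, h, smul_mul_assoc, mul_assoc, h', mul_smul_comm, smul_smul, mul_assoc]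

theorem mul_mul_eq_smul' {c d : K} {x y z : A} (h : x * z = c • (z * x))
    (h' : y * z = d • (z * y)) : x * y * z = (c * d) • (z * (x * y)) := by
  rw [mul_assoc, h', mul_smul_comm, ← mul_assoc, h, smul_mul_assoc, smul_smul, mul_assoc, mul_comm]

theorem prod_mul_prod_eq_zpow_smul {q : K} (hq : q ≠ 0) {x y : ℕ → A} {F : ℕ → ℕ → ℤ} {N M : ℕ}
    (hN : ∀ k ≤ N, F k 0 = 0) (hM : ∀ l ≤ M, F 0 l = 0)
    (h : ∀ k < N, ∀ l < M, x k * y l =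
      q ^ (F (k + 1) (l + 1) - F k (l + 1) - F (k + 1) l + F k l) • (y l * x k)) :
    ((List.range N).map x).prod * ((List.range M).map y).prod =
      q ^ F N M • (((List.range M).map y).prod * ((List.range N).map x).prod) := by
  have key : ∀ k < N, ∀ m ≤ M, x k * ((List.range m).map y).prod =
      q ^ (F (k + 1) m - F k m) • (((List.range m).map y).prod * x k) := by
    intro k hk m
    induction m with
    | zero => intro _; simp [hN k hk.le, hN (k + 1) hk]
    | succ m ih =>
      intro hm
      rw [List.prod_range_succ, mul_mul_eq_smul (ih (by omega)) (h k hk m hm), ← zpow_add₀ hq]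
      congr 2
      ring
  have main : ∀ m ≤ N, ((List.range m).map x).prod * ((List.range M).map y).prod =
      q ^ F m M • (((List.range M).map y).prod * ((List.range m).map x).prod) := by
    intro m
    induction m with
    | zero => intro _; simp [hM M le_rfl]
    | succ m ih =>
      intro hm
      rw [List.prod_range_succ, mul_mul_eq_smul' (ih (by omega)) (key m hm M le_rfl),
        ← zpow_add₀ hq]
      congr 2
      ring
  exact main N le_rfl

end QCommute

theorem qq_ne_zero : qq ≠ 0 := RatFunc.X_ne_zero

theorem Xg_mul_Xg {n : ℕ} {u v : DnLabel} (hu : u.valid n) (hv : v.valid n) :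
    Xg n u * Xg n v = qq ^ eps2 n v u • (Xg n v * Xg n u) := by
  simp only [Xg, dif_pos hu, dif_pos hv, ← map_mul, ← map_smul]
  exact RingQuot.mkAlgHom_rel Kq (DnRel.comm ⟨u, hu⟩ ⟨v, hv⟩)

/-- The monomial `𝐢 q^{i+r} X_{f(−i)} X_{f(1−i)} ⋯ X_{f(r)}`. -/
def rowMonomial (n : ℕ) (f : ℤ → DnLabel) (i r : ℤ) : Dtorus n :=
  (ii * qq ^ (i + r)) • ((List.range (r + i + 1).toNat).map fun k : ℕ => Xg n (f (-i + k))).prod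

theorem ww_eq (n : ℕ) (i r : ℤ) : ww n i r = rowMonomial n (.V i) i r := by
  simp only [ww, Vprod, rowMonomial, bind_pure_cast, List.map_map, Function.comp_def]

theorem mm_eq (n : ℕ) (i r : ℤ) : mm n i r = rowMonomial n (Lam n i) i r := by
  simp only [mm, Lprod, rowMonomial, bind_pure_cast, List.map_map, Function.comp_def]

theorem rowMonomial_mul_rowMonomial {n : ℕ} {f g : ℤ → DnLabel} {i j r s : ℤ} (G : ℤ → ℤ → ℤ)
    (hr : -i ≤ r) (hs : -j ≤ s)
    (hf : ∀ k, -i ≤ k → k ≤ r → (f k).valid n) (hg : ∀ l, -j ≤ l → l ≤ s → (g l).valid n)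
    (hGr : ∀ k, -i - 1 ≤ k → k ≤ r → G k (-j - 1) = 0)
    (hGs : ∀ l, -j - 1 ≤ l → l ≤ s → G (-i - 1) l = 0)
    (h : ∀ k l, -i ≤ k → k ≤ r → -j ≤ l → l ≤ s → eps2 n (g l) (f k) =
      G k l - G (k - 1) l - G k (l - 1) + G (k - 1) (l - 1)) :
    rowMonomial n f i r * rowMonomial n g j s =
      qq ^ G r s • (rowMonomial n g j s * rowMonomial n f i r) := by
  have key := prod_mul_prod_eq_zpow_smul qq_ne_zero
    (x := fun k : ℕ => Xg n (f (-i + k))) (y := fun l : ℕ => Xg n (g (-j + l)))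
    (F := fun k l => G (-i - 1 + k) (-j - 1 + l)) (N := (r + i + 1).toNat)
    (M := (s + j + 1).toNat)
    (fun k hk => by simpa using hGr (-i - 1 + k) (by omega) (by omega))
    (fun l hl => by simpa using hGs (-j - 1 + l) (by omega) (by omega))
    (fun k hk l hl => by
      rw [Xg_mul_Xg (hf _ (by omega) (by omega)) (hg _ (by omega) (by omega)),
        h _ _ (by omega) (by omega) (by omega) (by omega)]
      congr 2
      push_cast
      ring_nf)
  have hN : -i - 1 + ((r + i + 1).toNat : ℤ) = r := by omega
  have hM : -j - 1 + ((s + j + 1).toNat : ℤ) = s := by omega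
  simp only [hN, hM] at key
  simp only [rowMonomial, smul_mul_assoc, mul_smul_comm, key, smul_smul]
  congr 1
  ring

/-- A labelling `R` of rows of vertices along which the exchange matrix agrees with that of the
rows `V_{i,r}`. -/
structure IsRowLabelling (n : ℕ) (R : ℤ → ℤ → DnLabel) : Prop where
  valid {a r : ℤ} : 1 ≤ a → a ≤ n → -a ≤ r → r ≤ a → (R a r).valid n
  eps2_eq {a r b s : ℤ} : 1 ≤ a → a ≤ n → 1 ≤ b → b ≤ n → -a ≤ r → r ≤ a → -b ≤ s → s ≤ b →
    eps2 n (R a r) (R b s) = eps2 n (.V a r) (.V b s)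

theorem isRowLabelling_V (n : ℕ) : IsRowLabelling n .V :=
  ⟨fun h₁ h₂ h₃ h₄ => ⟨h₁, h₂, h₃, h₄⟩, fun _ _ _ _ _ _ _ _ => rfl⟩

theorem isRowLabelling_Lam (n : ℕ) : IsRowLabelling n (Lam n) :=
  ⟨Lam_valid, eps2_Lam_Lam⟩

namespace IsRowLabelling

variable {n : ℕ} {R : ℤ → ℤ → DnLabel}

theorem mul_same_row (hR : IsRowLabelling n R)
    {i r s : ℤ} (hi : 1 ≤ i) (hin : i ≤ n) (hr : -i ≤ r) (hri : r ≤ i - 1)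
    (hs : -i ≤ s) (hsi : s ≤ i - 1) :
    rowMonomial n (R i) i r * rowMonomial n (R i) i s =
      qq ^ (2 * Int.sign (r - s)) • (rowMonomial n (R i) i s * rowMonomial n (R i) i r) := by
  have hsign : 2 * Int.sign (r - s) = rowExp i r s := by
    rw [rowExp, if_pos ⟨hr, hs⟩]
    rcases lt_trichotomy r s with h | rfl | h
    · rw [Int.sign_eq_neg_one_of_neg (by omega)]; omega
    · simp
    · rw [Int.sign_eq_one_of_pos (by omega)]; omega
  rw [hsign]
  refine rowMonomial_mul_rowMonomial (rowExp i) hr hs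
    (fun k _ _ => hR.valid hi hin (by omega) (by omega))
    (fun l _ _ => hR.valid hi hin (by omega) (by omega))
    (fun k _ _ => if_neg (by omega)) (fun l _ _ => if_neg (by omega)) fun k l _ _ _ _ => ?_
  rw [hR.eps2_eq hi hin hi hin (by omega) (by omega) (by omega) (by omega)]
  exact eps2_V_V_row hi hin (by omega) (by omega) (by omega) (by omega)

theorem commute_of_far (hR : IsRowLabelling n R)
    {i j r s : ℤ} (hi : 1 ≤ i) (hin : i ≤ n) (hj : 1 ≤ j) (hjn : j ≤ n)
    (h : 1 < (i - j).natAbs) (hr : -i ≤ r) (hri : r ≤ i - 1) (hs : -j ≤ s) (hsj : s ≤ j - 1) :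
    rowMonomial n (R i) i r * rowMonomial n (R j) j s =
      rowMonomial n (R j) j s * rowMonomial n (R i) i r := by
  have key := rowMonomial_mul_rowMonomial (fun _ _ => 0) hr hs
    (fun k _ _ => hR.valid hi hin (by omega) (by omega))
    (fun l _ _ => hR.valid hj hjn (by omega) (by omega)) (fun _ _ _ => rfl) (fun _ _ _ => rfl)
    fun k l _ _ _ _ => by
      rw [hR.eps2_eq hj hjn hi hin (by omega) (by omega) (by omega) (by omega),
        eps2_V_V_far h]
      rfl
  simpa using key

theorem mul_adjacent_row (hR : IsRowLabelling n R)
    {i t r : ℤ} (hi : 1 ≤ i) (hin : i + 1 ≤ n) (ht : -i ≤ t)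
    (hti : t ≤ i - 1) (hr : -(i + 1) ≤ r) (hri : r ≤ i) :
    rowMonomial n (R (i + 1)) (i + 1) r * rowMonomial n (R i) i t =
      qq ^ adjExp i r t • (rowMonomial n (R i) i t * rowMonomial n (R (i + 1)) (i + 1) r) := by
  refine rowMonomial_mul_rowMonomial (adjExp i) hr ht
    (fun k _ _ => hR.valid (by omega) hin (by omega) (by omega))
    (fun l _ _ => hR.valid hi (by omega) (by omega) (by omega))
    (fun k _ _ => if_neg (by omega)) (fun l _ _ => if_neg (by omega)) fun k l _ _ _ _ => ?_
  rw [hR.eps2_eq hi (by omega) (by omega) hin (by omega) (by omega) (by omega) (by omega)]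
  exact eps2_V_V_adj hi hin (by omega) (by omega) (by omega) (by omega)

theorem mul_adjacent_row_lhd (hR : IsRowLabelling n R)
    {i t r : ℤ} (hi : 1 ≤ i) (hin : i + 1 ≤ n) (ht : -i ≤ t)
    (hti : t ≤ i - 1) (hr : -(i + 1) ≤ r) (hri : r ≤ i) :
    (lhd t r → rowMonomial n (R (i + 1)) (i + 1) r * rowMonomial n (R i) i t =
      qq⁻¹ • (rowMonomial n (R i) i t * rowMonomial n (R (i + 1)) (i + 1) r)) ∧
    (¬ lhd t r → rowMonomial n (R (i + 1)) (i + 1) r * rowMonomial n (R i) i t =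
      qq • (rowMonomial n (R i) i t * rowMonomial n (R (i + 1)) (i + 1) r)) := by
  have hlhd : lhd t r ↔ (r < 0 ∧ t ≤ r ∨ 0 ≤ r ∧ t < r) := by
    unfold lhd
    split_ifs <;> omega
  rw [hR.mul_adjacent_row hi hin ht hti hr hri, adjExp, if_pos ⟨hr, ht⟩, hlhd]
  constructor <;> intro h
  · rw [if_pos h, zpow_neg_one]
  · rw [if_neg h, zpow_one]

end IsRowLabelling

theorem ww_mul_mm {n : ℕ} {i j r s : ℤ} (hi : 1 ≤ i) (hin : i ≤ n) (hj : 1 ≤ j) (hjn : j ≤ n)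
    (hr : -i ≤ r) (hri : r ≤ i - 1) (hs : -j ≤ s) (hsj : s ≤ j - 1) :
    ww n i r * mm n j s = qq ^ mixedExp n i j r s • (mm n j s * ww n i r) := by
  rw [ww_eq, mm_eq]
  refine rowMonomial_mul_rowMonomial (mixedExp n i j) hr hs
    (fun k _ _ => (isRowLabelling_V n).valid hi hin (by omega) (by omega))
    (fun l _ _ => (isRowLabelling_Lam n).valid hj hjn (by omega) (by omega))
    (fun k _ _ => ?_) (fun l _ _ => ?_) fun k l _ _ _ _ => ?_
  · simp (disch := omega) only [mixedExp, if_neg]; rfl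
  · simp (disch := omega) only [mixedExp, if_neg]; rfl
  · exact eps2_Lam_V hi hin hj hjn (by omega) (by omega) (by omega) (by omega)

/-- Commutation relations between the cluster monomials `w_i^r` and
`m_j^s` in the quantum torus `𝒟ₙ`. -/
theorem statement7 (n : ℕ) (hn : 1 ≤ n) :
    -- (1)  w_i^r w_i^s = q^{2·sgn(r−s)} w_i^s w_i^r
    (∀ i r s : ℤ, 1 ≤ i → i ≤ (n : ℤ) → -i ≤ r → r ≤ i - 1 → -i ≤ s → s ≤ i - 1 →
      ww n i r * ww n i s = (qq ^ (2 * Int.sign (r - s))) • (ww n i s * ww n i r)) ∧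
    -- (2)  w_i^r w_j^s = w_j^s w_i^r  for |i−j| > 1
    (∀ i j r s : ℤ, 1 ≤ i → i ≤ (n : ℤ) → 1 ≤ j → j ≤ (n : ℤ) → 1 < (i - j).natAbs →
      -i ≤ r → r ≤ i - 1 → -j ≤ s → s ≤ j - 1 →
      ww n i r * ww n j s = ww n j s * ww n i r) ∧
    -- (3)  w_{i+1}^r w_i^t = q^{∓1} w_i^t w_{i+1}^r  according to t ⊲ r or t ⊳ r
    (∀ i t r : ℤ, 1 ≤ i → i + 1 ≤ (n : ℤ) → -i ≤ t → t ≤ i - 1 → -(i + 1) ≤ r → r ≤ i →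
      (lhd t r → ww n (i + 1) r * ww n i t = qq⁻¹ • (ww n i t * ww n (i + 1) r)) ∧
      (¬ lhd t r → ww n (i + 1) r * ww n i t = qq • (ww n i t * ww n (i + 1) r))) ∧
    -- (4)  m_i^r m_i^s = q^{2·sgn(r−s)} m_i^s m_i^r
    (∀ i r s : ℤ, 1 ≤ i → i ≤ (n : ℤ) → -i ≤ r → r ≤ i - 1 → -i ≤ s → s ≤ i - 1 →
      mm n i r * mm n i s = (qq ^ (2 * Int.sign (r - s))) • (mm n i s * mm n i r)) ∧
    -- (5)  m_i^r m_j^s = m_j^s m_i^r  for |i−j| > 1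
    (∀ i j r s : ℤ, 1 ≤ i → i ≤ (n : ℤ) → 1 ≤ j → j ≤ (n : ℤ) → 1 < (i - j).natAbs →
      -i ≤ r → r ≤ i - 1 → -j ≤ s → s ≤ j - 1 →
      mm n i r * mm n j s = mm n j s * mm n i r) ∧
    -- (6)  m_{i+1}^r m_i^t = q^{∓1} m_i^t m_{i+1}^r  according to t ⊲ r or t ⊳ r
    (∀ i t r : ℤ, 1 ≤ i → i + 1 ≤ (n : ℤ) → -i ≤ t → t ≤ i - 1 → -(i + 1) ≤ r → r ≤ i →
      (lhd t r → mm n (i + 1) r * mm n i t = qq⁻¹ • (mm n i t * mm n (i + 1) r)) ∧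
      (¬ lhd t r → mm n (i + 1) r * mm n i t = qq • (mm n i t * mm n (i + 1) r))) ∧
    -- (7)  relations between w_i^r and m_j^s
    (∀ i j r s : ℤ, 1 ≤ i → i ≤ (n : ℤ) → 1 ≤ j → j ≤ (n : ℤ) →
      -i ≤ r → r ≤ i - 1 → -j ≤ s → s ≤ j - 1 →
      (i + j < (n : ℤ) + 1 → ww n i r * mm n j s = mm n j s * ww n i r) ∧
      (i + j = (n : ℤ) + 1 →
        (if (r, s) = (-i, j - 1) then
          ww n i r * mm n j s = (qq ^ (2 : ℤ)) • (mm n j s * ww n i r)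
        else if (r, s) = (i - 1, -j) then
          ww n i r * mm n j s = (qq ^ (-2 : ℤ)) • (mm n j s * ww n i r)
        else ww n i r * mm n j s = mm n j s * ww n i r)) ∧
      ((n : ℤ) + 1 < i + j →
        (if (r, s) = (th n j, -(th n i) - 1) ∨ (r, s) = (-(th n j), th n i - 1) then
          ww n i r * mm n j s = (qq ^ (2 : ℤ)) • (mm n j s * ww n i r)
        else if (r, s) = (-(th n j) - 1, th n i) ∨ (r, s) = (th n j - 1, -(th n i)) then
          ww n i r * mm n j s = (qq ^ (-2 : ℤ)) • (mm n j s * ww n i r)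
        else ww n i r * mm n j s = mm n j s * ww n i r))) := by
  have hV := isRowLabelling_V n
  have hL := isRowLabelling_Lam n
  refine ⟨?_, ?_, ?_, ?_, ?_, ?_, ?_⟩
  · intro i r s hi hin hr hri hs hsi
    simpa only [ww_eq] using hV.mul_same_row hi hin hr hri hs hsi
  · intro i j r s hi hin hj hjn hij hr hri hs hsj
    simpa only [ww_eq] using hV.commute_of_far hi hin hj hjn hij hr hri hs hsj
  · intro i t r hi hin ht hti hr hri
    simpa only [ww_eq] using hV.mul_adjacent_row_lhd hi hin ht hti hr hri
  · intro i r s hi hin hr hri hs hsi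
    simpa only [mm_eq] using hL.mul_same_row hi hin hr hri hs hsi
  · intro i j r s hi hin hj hjn hij hr hri hs hsj
    simpa only [mm_eq] using hL.commute_of_far hi hin hj hjn hij hr hri hs hsj
  · intro i t r hi hin ht hti hr hri
    simpa only [mm_eq] using hL.mul_adjacent_row_lhd hi hin ht hti hr hri
  · intro i j r s hi hin hj hjn hr hri hs hsj
    have key := ww_mul_mm hi hin hj hjn hr hri hs hsj
    have key_of {e : ℤ} (he : mixedExp n i j r s = e) :
        ww n i r * mm n j s = qq ^ e • (mm n j s * ww n i r) := he ▸ key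
    have comm_of (he : mixedExp n i j r s = 0) : ww n i r * mm n j s = mm n j s * ww n i r := by
      rw [key_of he, zpow_zero, one_smul]
    simp only [Prod.mk.injEq, th]
    refine ⟨fun h => comm_of ?_, fun h => ?_, fun h => ?_⟩
    · simp (disch := omega) only [mixedExp, if_neg]; rfl
    all_goals
      split_ifs with h₁ h₂
      · refine key_of ?_
        simp only [mixedExp]
        omega
      · refine key_of ?_
        simp only [mixedExp]
        omega
      · refine comm_of ?_
        simp (disch := omega) only [mixedExp, if_neg]; rfl

end
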